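/- Let μ be a finite positive Borel measure on the unit circle and n ≥ 2. For every holomorphic f on the disc with D_{μ,n}(f) < ∞ and every j with 1 ≤ j ≤ n-1, one has Σ_{k=1}^∞ D_{μ,j}(L^k f) = D_{μ,j+1}(f), where L is the backward shift Lf(z) = (f(z)-f(0))/z. -/

import Mathlib

open MeasureTheory
open scoped ENNReal

/-- Normalized Lebesgue area measure on `ℂ` (total mass `1` on the unit disc). -/
noncomputable def area : Measure ℂ := (ENNReal.ofReal Real.pi)⁻¹ • volume

/-- The Poisson integral `P_μ(z) = ∫ (1-|z|²)/|z-ζ|² dμ(ζ)` of a finite positive Borel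
measure `μ` on the unit circle. -/
noncomputable def poisson (μ : Measure ℂ) (z : ℂ) : ℝ :=
  ∫ ζ, (1 - ‖z‖ ^ 2) / ‖z - ζ‖ ^ 2 ∂μ

/-- The weighted Dirichlet integral of order `n ≥ 1`:
`D_{μ,n}(f) = (1/(n!(n-1)!)) ∫_D P_μ(z)|f⁽ⁿ⁾(z)|²(1-|z|²)^{n-1} dA(z)`,
as an extended nonnegative real. -/
noncomputable def eDirichlet (μ : Measure ℂ) (n : ℕ) (f : ℂ → ℂ) : ℝ≥0∞ :=
  (((n.factorial * (n - 1).factorial : ℕ) : ℝ≥0∞))⁻¹ *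
    ∫⁻ z in Metric.ball (0 : ℂ) 1,
      ENNReal.ofReal (poisson μ z * ‖iteratedDeriv n f z‖ ^ 2 * (1 - ‖z‖ ^ 2) ^ (n - 1)) ∂area

/-- The backward shift `Lf(z) = (f(z) - f(0))/z` (with the removable singularity at `0`
filled in by `f'(0)`). -/
noncomputable def bshift (f : ℂ → ℂ) : ℂ → ℂ :=
  fun z => if z = 0 then deriv f 0 else (f z - f 0) / z


/-- partial sums -/
noncomputable def sS (j : ℕ) (a : ℕ → ℂ) (N : ℕ) : ℂ :=
  ∑ m ∈ Finset.range (N + 1), (Nat.choose m j : ℂ) * a m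

noncomputable def sT (p : ℕ) (b : ℕ → ℂ) (N : ℕ) : ℂ :=
  ∑ m ∈ Finset.range N, (Nat.choose m p : ℂ) * b m

noncomputable def sw (p : ℕ) (N : ℕ) : ℝ :=
  (Nat.choose N p : ℝ) / ((Nat.choose N (p + 1) : ℝ) * (Nat.choose (N + 1) (p + 1) : ℝ))

noncomputable def sD (p : ℕ) (a : ℕ → ℂ) : ℝ≥0∞ :=
  ∑' N, ENNReal.ofReal (sw p N * ‖sS (p + 1) a N‖ ^ 2)

lemma sw_nonneg (p N : ℕ) : 0 ≤ sw p N := by unfold sw; positivity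

lemma sS_eq (p : ℕ) (a b : ℕ → ℂ) (h : ∀ m, a (m + 1) = b m - b (m + 1)) (N : ℕ) :
    sS (p + 1) a N = sT p b N - (Nat.choose N (p + 1) : ℂ) * b N := by
  induction N with
  | zero => simp [sS, sT]
  | succ N ih =>
    have h1 : sS (p + 1) a (N + 1) = sS (p + 1) a N + (Nat.choose (N + 1) (p + 1) : ℂ) * a (N + 1) := by
      simp [sS, Finset.sum_range_succ]
    have h2 : sT p b (N + 1) = sT p b N + (Nat.choose N p : ℂ) * b N := by
      simp [sT, Finset.sum_range_succ]
    rw [h1, h2, ih, h, Nat.choose_succ_succ]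
    push_cast
    ring

lemma sT_zero (p : ℕ) (b : ℕ → ℂ) (N : ℕ) (h : N ≤ p) : sT p b N = 0 := by
  unfold sT
  apply Finset.sum_eq_zero
  intro m hm
  rw [Nat.choose_eq_zero_of_lt (by have := Finset.mem_range.1 hm; omega)]
  simp

lemma alg_id (c B : ℝ) (hc : 0 < c) (hB : 0 < B) (b T : ℂ) :
    B * ‖b‖ ^ 2 + ‖T‖ ^ 2 / c = B / (c * (B + c)) * ‖T - c * b‖ ^ 2 + ‖T + B * b‖ ^ 2 / (B + c) := by
  simp only [Complex.sq_norm, Complex.normSq_apply]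
  simp
  have : B + c ≠ 0 := by positivity
  field_simp
  ring

lemma finite_id (p : ℕ) (a b : ℕ → ℂ) (h : ∀ m, a (m + 1) = b m - b (m + 1)) (M : ℕ) :
    ∑ N ∈ Finset.range M, (Nat.choose N p : ℝ) * ‖b N‖ ^ 2 =
      ∑ N ∈ Finset.range M, sw p N * ‖sS (p + 1) a N‖ ^ 2
        + ‖sT p b M‖ ^ 2 / (Nat.choose M (p + 1) : ℝ) := by
  induction M with
  | zero => simp [sT]
  | succ M ih =>
    rw [Finset.sum_range_succ, Finset.sum_range_succ, ih]
    have h2 : sT p b (M + 1) = sT p b M + (Nat.choose M p : ℂ) * b M := by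
      simp [sT, Finset.sum_range_succ]
    rcases lt_trichotomy M p with hM | hM | hM
    · rw [sT_zero p b _ (by omega), sT_zero p b _ (by omega), sw, Nat.choose_eq_zero_of_lt hM]
      simp
    · subst hM
      rw [h2, sT_zero M b _ (by omega), sw]
      simp
    · rw [sS_eq p a b h, h2, sw, Nat.choose_succ_succ]
      have := alg_id (Nat.choose M (p + 1)) (Nat.choose M p) (by exact_mod_cast Nat.choose_pos hM)
        (by exact_mod_cast Nat.choose_pos hM.le) (b M) (sT p b M)
      push_cast at this ⊢
      linarith

lemma sw_tel (p N : ℕ) (h : p < N) :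
    sw p N = 1 / (Nat.choose N (p + 1) : ℝ) - 1 / (Nat.choose (N + 1) (p + 1) : ℝ) := by
  rw [sw, Nat.choose_succ_succ]
  have h1 : (0:ℝ) < Nat.choose N (p + 1) := by exact_mod_cast Nat.choose_pos h
  have h2 : (0:ℝ) < Nat.choose N p := by exact_mod_cast Nat.choose_pos h.le
  push_cast
  field_simp
  ring

lemma sw_sum (p M : ℕ) (h : p < M) (M' : ℕ) (h' : M ≤ M') :
    ∑ N ∈ Finset.Ico M M', sw p N = 
      1 / (Nat.choose M (p + 1) : ℝ) - 1 / (Nat.choose M' (p + 1) : ℝ) := by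
  induction M', h' using Nat.le_induction with
  | base => simp
  | succ k hk ih => 
    rw [Finset.sum_Ico_succ_top hk, ih, sw_tel p k (by omega)]; ring

lemma sw_summable (p : ℕ) : Summable (sw p) := by
  rw [← summable_nat_add_iff (p + 1)]
  apply summable_of_sum_range_le (c := 1) (fun n => sw_nonneg _ _)
  intro n
  have := sw_sum p (p + 1) (by omega) (p + 1 + n) (by omega)
  rw [Finset.sum_Ico_eq_sum_range] at this
  simp only [add_tsub_cancel_left] at this
  simp only [add_comm _ (p + 1)]
  rw [this]
  simp

section
open Filter Topology

lemma lemY (p : ℕ) (a : ℕ → ℂ) (hs : Summable fun N => sw p N * ‖sS (p + 1) a N‖ ^ 2) :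
    ∃ b : ℕ → ℂ, (∀ m, a (m + 1) = b m - b (m + 1)) ∧ Tendsto b atTop (𝓝 0) ∧
      Tendsto (fun M => ‖sT p b M‖ ^ 2 / (Nat.choose M (p + 1) : ℝ)) atTop (𝓝 0) := by
  set b0 : ℕ → ℂ := fun m => - ∑ i ∈ Finset.range (m + 1), a i with hb0
  have hb0' : ∀ m, a (m + 1) = b0 m - b0 (m + 1) := by
    intro m; simp [hb0, Finset.sum_range_succ _ (m + 1)]
  set τ : ℕ → ℂ := fun M => sT p b0 M / (Nat.choose M (p + 1) : ℂ) with hτ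
  have hτd : ∀ M, p < M → τ (M + 1) - τ M = - (sw p M : ℂ) * sS (p + 1) a M := by
    intro M hM
    have h2 : sT p b0 (M + 1) = sT p b0 M + (Nat.choose M p : ℂ) * b0 M := by
      simp [sT, Finset.sum_range_succ]
    have c1 : (Nat.choose M (p + 1) : ℂ) ≠ 0 := by exact_mod_cast (Nat.choose_pos hM).ne'
    have c2 : (Nat.choose M p + Nat.choose M (p + 1) : ℂ) ≠ 0 := by
      have : Nat.choose M p + Nat.choose M (p + 1) ≠ 0 := by
        have := Nat.choose_pos hM.le
        omega
      exact_mod_cast this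
    simp only [hτ]
    rw [sS_eq p a b0 hb0', h2, sw, Nat.choose_succ_succ]
    push_cast
    field_simp
    ring
  have hcau : CauchySeq τ := by
    apply cauchySeq_of_summable_dist
    rw [← summable_nat_add_iff (p + 1)]
    have hbig := (summable_nat_add_iff (p + 1)).2 ((sw_summable p).add hs)
    refine Summable.of_nonneg_of_le (fun _ => dist_nonneg) ?_ hbig
    intro n
    rw [dist_comm, dist_eq_norm, hτd _ (by omega), norm_mul, norm_neg, Complex.norm_real,
      Real.norm_of_nonneg (sw_nonneg _ _)]
    have := sw_nonneg p (n + (p + 1))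
    nlinarith [sq_nonneg (‖sS (p + 1) a (n + (p + 1))‖ - 1), sq_nonneg (‖sS (p + 1) a (n + (p + 1))‖)]
  obtain ⟨t, ht⟩ := cauchySeq_tendsto_of_complete hcau
  have hchoose : ∀ M, ∑ m ∈ Finset.range M, (Nat.choose m p : ℂ) = (Nat.choose M (p + 1) : ℂ) := by
    intro M
    induction M with
    | zero => simp
    | succ M ih => rw [Finset.sum_range_succ, ih, Nat.choose_succ_succ]; push_cast; ring
  set b : ℕ → ℂ := fun m => b0 m - t with hb
  have hb' : ∀ m, a (m + 1) = b m - b (m + 1) := by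
    intro m; simp [hb, hb0']
  have hTb : ∀ M, p < M → sT p b M = (Nat.choose M (p + 1) : ℂ) * (τ M - t) := by
    intro M hM
    have c1 : (Nat.choose M (p + 1) : ℂ) ≠ 0 := by exact_mod_cast (Nat.choose_pos hM).ne'
    rw [mul_sub, hτ]
    simp only
    rw [mul_div_cancel₀ _ c1, ← hchoose M, Finset.sum_mul]
    simp only [sT, hb, ← Finset.sum_sub_distrib, mul_sub]
  have hR : Tendsto (fun M => ‖sT p b M‖ ^ 2 / (Nat.choose M (p + 1) : ℝ)) atTop (𝓝 0) := by
    have htail := tendsto_sum_nat_add (fun N => sw p N * ‖sS (p + 1) a N‖ ^ 2)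
    refine tendsto_of_tendsto_of_tendsto_of_le_of_le' tendsto_const_nhds htail 
      (Eventually.of_forall fun _ => by positivity) ?_
    filter_upwards [eventually_gt_atTop p] with M hM
    have c1 : (0:ℝ) < (Nat.choose M (p + 1) : ℝ) := by exact_mod_cast (Nat.choose_pos hM)
    set Q := ∑' k, sw p (k + M) * ‖sS (p + 1) a (k + M)‖ ^ 2 with hQ
    have key : ∀ M', M ≤ M' → ‖τ M - τ M'‖ ^ 2 ≤ 1 / (Nat.choose M (p + 1) : ℝ) * Q := by
      intro M' hM'
      have e1 : τ M' - τ M = ∑ N ∈ Finset.Ico M M', - (sw p N : ℂ) * sS (p + 1) a N := by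
        rw [← Finset.sum_Ico_sub τ hM']
        apply Finset.sum_congr rfl
        intro N hN
        exact hτd N (by have := Finset.mem_Ico.1 hN; omega)
      have e2 : ‖τ M - τ M'‖ ≤ ∑ N ∈ Finset.Ico M M', sw p N * ‖sS (p + 1) a N‖ := by
        rw [norm_sub_rev, e1]
        refine (norm_sum_le _ _).trans (le_of_eq (Finset.sum_congr rfl fun N _ => ?_))
        rw [norm_mul, norm_neg, Complex.norm_real, Real.norm_of_nonneg (sw_nonneg _ _)]
      have e3 : (∑ N ∈ Finset.Ico M M', sw p N * ‖sS (p + 1) a N‖) ^ 2 ≤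
          (∑ N ∈ Finset.Ico M M', sw p N) * ∑ N ∈ Finset.Ico M M', sw p N * ‖sS (p + 1) a N‖ ^ 2 := by
        apply Finset.sum_sq_le_sum_mul_sum_of_sq_le_mul
        · intro i _; exact sw_nonneg _ _
        · intro i _; exact mul_nonneg (sw_nonneg _ _) (by positivity)
        · intro i _; apply le_of_eq; ring
      have e4 : ∑ N ∈ Finset.Ico M M', sw p N ≤ 1 / (Nat.choose M (p + 1) : ℝ) := by
        rw [sw_sum p M hM M' hM']
        have : (0:ℝ) ≤ 1 / (Nat.choose M' (p + 1) : ℝ) := by positivity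
        linarith
      have e5 : ∑ N ∈ Finset.Ico M M', sw p N * ‖sS (p + 1) a N‖ ^ 2 ≤ Q := by
        rw [Finset.sum_Ico_eq_sum_range, hQ]
        simp only [add_comm M]
        exact Summable.sum_le_tsum (f := fun k => sw p (k + M) * ‖sS (p + 1) a (k + M)‖ ^ 2) _
          (fun i _ => mul_nonneg (sw_nonneg _ _) (by positivity))
          ((summable_nat_add_iff M).2 hs)
      calc ‖τ M - τ M'‖ ^ 2 ≤ (∑ N ∈ Finset.Ico M M', sw p N * ‖sS (p + 1) a N‖) ^ 2 := by gcongr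
        _ ≤ _ := e3
        _ ≤ _ := mul_le_mul e4 e5 (Finset.sum_nonneg fun i _ => mul_nonneg (sw_nonneg _ _) (by positivity)) (by positivity)
    have hlim : ‖τ M - t‖ ^ 2 ≤ 1 / (Nat.choose M (p + 1) : ℝ) * Q := by
      refine le_of_tendsto (((tendsto_const_nhds.sub ht).norm).pow 2) ?_
      filter_upwards [eventually_ge_atTop M] with M' hM' using key M' hM'
    rw [hTb M hM, norm_mul, Complex.norm_natCast, mul_pow]
    calc _ = (Nat.choose M (p + 1) : ℝ) * ‖τ M - t‖ ^ 2 := by field_simp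
      _ ≤ (Nat.choose M (p + 1) : ℝ) * (1 / (Nat.choose M (p + 1) : ℝ) * Q) := by gcongr
      _ = Q := by field_simp
  refine ⟨b, hb', ?_, hR⟩
  -- partial sums converge
  have hA : Tendsto (fun M => ∑ N ∈ Finset.range M, (Nat.choose N p : ℝ) * ‖b N‖ ^ 2) atTop
      (𝓝 (∑' N, sw p N * ‖sS (p + 1) a N‖ ^ 2)) := by
    have := hs.hasSum.tendsto_sum_nat.add hR
    rw [add_zero] at this
    refine this.congr fun M => (finite_id p a b hb' M).symm
  have hB : Tendsto (fun N => (Nat.choose N p : ℝ) * ‖b N‖ ^ 2) atTop (𝓝 0) := by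
    have h1 := ((tendsto_add_atTop_iff_nat 1).2 hA).sub hA
    rw [sub_self] at h1
    refine h1.congr fun M => ?_
    simp [Finset.sum_range_succ]
  have hC : Tendsto (fun N => ‖b N‖ ^ 2) atTop (𝓝 0) := by
    refine tendsto_of_tendsto_of_tendsto_of_le_of_le' tendsto_const_nhds hB 
      (Eventually.of_forall fun _ => by positivity) ?_
    filter_upwards [eventually_ge_atTop p] with N hN
    have : (1:ℝ) ≤ Nat.choose N p := by exact_mod_cast Nat.choose_pos hN
    nlinarith [sq_nonneg ‖b N‖]
  rw [tendsto_zero_iff_norm_tendsto_zero]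
  have := hC.sqrt
  simpa using this

lemma tsum_eq_of_partial (u v : ℕ → ℝ) (R : ℕ → ℝ) (hu : ∀ n, 0 ≤ u n) (hv : ∀ n, 0 ≤ v n)
    (hR : Tendsto R atTop (𝓝 0)) 
    (h : ∀ M, ∑ N ∈ Finset.range M, u N = ∑ N ∈ Finset.range M, v N + R M) (hs : Summable v) :
    ∑' N, ENNReal.ofReal (u N) = ∑' N, ENNReal.ofReal (v N) := by
  have h1 := hs.hasSum.tendsto_sum_nat.add hR
  rw [add_zero] at h1
  have h2 : HasSum u (∑' i, v i) := (hasSum_iff_tendsto_nat_of_nonneg hu _).2 (h1.congr fun M => (h M).symm)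
  rw [← ENNReal.ofReal_tsum_of_nonneg hu h2.summable, ← ENNReal.ofReal_tsum_of_nonneg hv hs, h2.tsum_eq]

lemma summable_of_tsum_ne_top (v : ℕ → ℝ) (hv : ∀ n, 0 ≤ v n)
    (h : ∑' N, ENNReal.ofReal (v N) ≠ ⊤) : Summable v := by
  have := ENNReal.summable_toReal h
  refine this.congr fun n => ENNReal.toReal_ofReal (hv n)

lemma lemX (p : ℕ) (a b : ℕ → ℂ) (h : ∀ m, a (m + 1) = b m - b (m + 1))
    (hb : Tendsto b atTop (𝓝 0)) :
    sD p a = ∑' N, ENNReal.ofReal ((Nat.choose N p : ℝ) * ‖b N‖ ^ 2) := by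
  have hv : ∀ N, 0 ≤ sw p N * ‖sS (p + 1) a N‖ ^ 2 := fun N => 
    mul_nonneg (sw_nonneg _ _) (by positivity)
  have hu : ∀ N, 0 ≤ (Nat.choose N p : ℝ) * ‖b N‖ ^ 2 := fun N => by positivity
  by_cases hD : sD p a = ⊤
  · symm
    rw [hD]
    by_contra hne
    have hsu := summable_of_tsum_ne_top _ hu hne
    apply ENNReal.ofReal_ne_top (r := ∑' N, (Nat.choose N p : ℝ) * ‖b N‖ ^ 2)
    rw [eq_top_iff, ← hD, sD]
    have : Summable fun N => sw p N * ‖sS (p + 1) a N‖ ^ 2 := by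
      refine summable_of_sum_range_le (c := ∑' N, (Nat.choose N p : ℝ) * ‖b N‖ ^ 2) hv fun M => ?_
      have e1 := finite_id p a b h M
      have e2 : 0 ≤ ‖sT p b M‖ ^ 2 / (Nat.choose M (p + 1) : ℝ) := by positivity
      have e3 := hsu.sum_le_tsum (Finset.range M) (fun i _ => hu i)
      linarith
    exfalso
    apply ENNReal.ofReal_ne_top (r := ∑' N, sw p N * ‖sS (p + 1) a N‖ ^ 2)
    rw [ENNReal.ofReal_tsum_of_nonneg hv this]
    exact hD
  · have hs := summable_of_tsum_ne_top _ hv hD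
    obtain ⟨b', h', hb', hR⟩ := lemY p a hs
    have hbb : b' = b := by
      have hd : ∀ m, b m - b' m = b 0 - b' 0 := by
        intro m
        induction m with
        | zero => rfl
        | succ m ih => 
          rw [← ih]
          linear_combination h m - h' m
      have hl := hb.sub hb'
      simp only [hd, sub_zero] at hl
      have h0 := tendsto_nhds_unique hl tendsto_const_nhds
      funext m
      have := hd m
      rw [← h0, sub_eq_zero] at this
      exact this.symm
    subst hbb
    exact (tsum_eq_of_partial _ _ _ hu hv hR (fun M => finite_id p a b' h' M) hs).symm

lemma hockey (p : ℕ) (u : ℕ → ℝ≥0∞) :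
    ∑' k : ℕ, ∑' N : ℕ, (Nat.choose N p : ℝ≥0∞) * u (N + (k + 1)) = 
      ∑' m : ℕ, (Nat.choose m (p + 1) : ℝ≥0∞) * u m := by
  have hch : ∀ m, (Nat.choose m (p + 1) : ℝ≥0∞) = ∑ N ∈ Finset.range m, (Nat.choose N p : ℝ≥0∞) := by
    intro m
    induction m with
    | zero => simp
    | succ M ih => rw [Finset.sum_range_succ, ← ih, Nat.choose_succ_succ]; push_cast; ring
  rw [ENNReal.tsum_comm]
  have h1 : ∀ N : ℕ, ∑' k : ℕ, (Nat.choose N p : ℝ≥0∞) * u (N + (k + 1)) = 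
      ∑' m : ℕ, if N < m then (Nat.choose N p : ℝ≥0∞) * u m else 0 := by
    intro N
    have h3 := Summable.sum_add_tsum_nat_add' (k := N + 1)
      (f := fun m => if N < m then (Nat.choose N p : ℝ≥0∞) * u m else 0) ENNReal.summable
    rw [← h3, Finset.sum_eq_zero, zero_add]
    · apply tsum_congr
      intro k
      rw [if_pos (by omega), show k + (N + 1) = N + (k + 1) by omega]
    · intro i hi
      rw [if_neg (by have := Finset.mem_range.1 hi; omega)]
  simp only [h1]
  rw [ENNReal.tsum_comm]
  apply tsum_congr
  intro m
  rw [hch, Finset.sum_mul]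
  rw [tsum_eq_sum (s := Finset.range m)]
  · apply Finset.sum_congr rfl
    intro N hN
    rw [if_pos (Finset.mem_range.1 hN)]
  · intro N hN
    rw [if_neg (by simpa using hN)]

lemma seq_main (p : ℕ) (a : ℕ → ℂ) :
    ∑' k : ℕ, sD p (fun m => a (m + (k + 1))) = sD (p + 1) a := by
  have hv : ∀ p a N, 0 ≤ sw p N * ‖sS (p + 1) a N‖ ^ 2 := fun p a N => 
    mul_nonneg (sw_nonneg _ _) (by positivity)
  have main : (∃ b : ℕ → ℂ, (∀ m, a (m + 1) = b m - b (m + 1)) ∧ Tendsto b atTop (𝓝 0)) → 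
      ∑' k : ℕ, sD p (fun m => a (m + (k + 1))) = sD (p + 1) a := by
    rintro ⟨b, h, hb⟩
    rw [lemX (p + 1) a b h hb]
    have : ∀ k : ℕ, sD p (fun m => a (m + (k + 1))) = 
        ∑' N, (Nat.choose N p : ℝ≥0∞) * ENNReal.ofReal (‖b (N + (k + 1))‖ ^ 2) := by
      intro k
      rw [lemX p _ (fun m => b (m + (k + 1))) _ ((tendsto_add_atTop_iff_nat _).2 hb)]
      · apply tsum_congr
        intro N
        rw [ENNReal.ofReal_mul (by positivity), ENNReal.ofReal_natCast]
      · intro m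
        have := h (m + (k + 1))
        simp only [show m + 1 + (k + 1) = m + (k + 1) + 1 by omega]
        exact this
    simp only [this]
    rw [hockey p (fun m => ENNReal.ofReal (‖b m‖ ^ 2))]
    apply tsum_congr
    intro N
    rw [ENNReal.ofReal_mul (by positivity), ENNReal.ofReal_natCast]
  by_cases h1 : sD (p + 1) a = ⊤
  · by_cases h2 : sD p (fun m => a (m + (0 + 1))) = ⊤
    · rw [h1]
      exact ENNReal.tsum_eq_top_of_eq_top ⟨0, h2⟩
    · apply main
      obtain ⟨b', h', hb', hR⟩ := lemY p _ (summable_of_tsum_ne_top _ (hv _ _) h2)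
      refine ⟨fun m => Nat.casesOn m (a 1 + b' 0) b', ?_, ?_⟩
      · intro m
        cases m with
        | zero => simp
        | succ m => simpa using h' m
      · rw [← tendsto_add_atTop_iff_nat 1]
        exact hb'
  · apply main
    obtain ⟨b', h', hb', hR⟩ := lemY (p + 1) a (summable_of_tsum_ne_top _ (hv _ _) h1)
    exact ⟨b', h', hb'⟩

end

lemma beta_int (j : ℕ) : ∀ k : ℕ, ∫ r in (0:ℝ)..1, 2 * r ^ (2 * k + 1) * (1 - r ^ 2) ^ j =
    (k.factorial * j.factorial : ℝ) / (k + j + 1).factorial := by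
  induction j with
  | zero =>
    intro k
    simp only [pow_zero, mul_one, intervalIntegral.integral_const_mul, integral_pow]
    rw [show k + 0 + 1 = k + 1 by rfl, Nat.factorial_succ]
    have := Nat.factorial_ne_zero k
    push_cast
    field_simp
    simp
    ring
  | succ j ih =>
    intro k
    have : ∀ r : ℝ, 2 * r ^ (2 * k + 1) * (1 - r ^ 2) ^ (j + 1) = 
      2 * r ^ (2 * k + 1) * (1 - r ^ 2) ^ j - 2 * r ^ (2 * (k + 1) + 1) * (1 - r ^ 2) ^ j := by
      intro r; ring
    simp only [this]
    rw [intervalIntegral.integral_sub, ih, ih]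
    · rw [show k + 1 + j + 1 = (k + j + 1) + 1 by ring, show k + (j + 1) + 1 = (k + j + 1) + 1 by ring,
        Nat.factorial_succ (k + j + 1), Nat.factorial_succ k, Nat.factorial_succ j]
      have := Nat.factorial_ne_zero (k + j + 1)
      push_cast
      field_simp
      ring
    · apply Continuous.intervalIntegrable; fun_prop
    · apply Continuous.intervalIntegrable; fun_prop

lemma beta_lint (j k : ℕ) : ∫⁻ r in Set.Ioo (0:ℝ) 1, ENNReal.ofReal (2 * r ^ (2 * k + 1) * (1 - r ^ 2) ^ j) =
    ENNReal.ofReal ((k.factorial * j.factorial : ℝ) / (k + j + 1).factorial) := by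
  rw [← beta_int, intervalIntegral.integral_of_le zero_le_one, integral_Ioc_eq_integral_Ioo]
  rw [ofReal_integral_eq_lintegral_ofReal]
  · have : IntegrableOn (fun r : ℝ => 2 * r ^ (2 * k + 1) * (1 - r ^ 2) ^ j) (Set.Icc 0 1) :=
      Continuous.integrableOn_Icc (by fun_prop)
    exact this.mono_set Set.Ioo_subset_Icc_self
  · filter_upwards [ae_restrict_mem measurableSet_Ioo] with r hr
    have h1 : 0 ≤ 1 - r ^ 2 := by nlinarith [hr.1, hr.2]
    have := hr.1
    simp only [Pi.zero_apply]
    positivity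

open Complex in
lemma parseval_aux (c : ℕ → ℂ) (hc : Summable fun k => ‖c k‖) (h : ℝ → ℂ) (hh : Continuous h) :
    HasSum (fun k => c k * ∫ θ in (-Real.pi)..Real.pi, exp (k * θ * I) * h θ) 
      (∫ θ in (-Real.pi)..Real.pi, (∑' k, c k * exp (k * θ * I)) * h θ) := by
  have hn : ∀ (k : ℕ) (θ : ℝ), ‖exp (k * θ * I)‖ = 1 := by
    intro k θ
    have := Complex.norm_exp_ofReal_mul_I (k * θ)
    push_cast at this
    exact this
  simp only [← intervalIntegral.integral_const_mul]
  apply intervalIntegral.hasSum_integral_of_dominated_convergence (fun k θ => ‖c k‖ * ‖h θ‖)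
  · intro k
    apply Continuous.aestronglyMeasurable
    fun_prop
  · intro k
    refine Filter.Eventually.of_forall fun θ _ => ?_
    rw [norm_mul, norm_mul, hn, one_mul]
  · refine Filter.Eventually.of_forall fun θ _ => hc.mul_right _
  · simp only [tsum_mul_right]
    apply Continuous.intervalIntegrable
    fun_prop
  · refine Filter.Eventually.of_forall fun θ _ => ?_
    simp only [← mul_assoc]
    apply HasSum.mul_right
    apply Summable.hasSum
    apply Summable.of_norm
    simpa only [norm_mul, hn, mul_one] using hc

open Complex in
lemma orth (k l : ℕ) : ∫ θ in (-Real.pi)..Real.pi, exp (k * (θ:ℝ) * I) * (starRingEnd ℂ) (exp (l * θ * I)) =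
    if k = l then (2 * Real.pi : ℂ) else 0 := by
  have : ∀ θ : ℝ, exp (k * θ * I) * (starRingEnd ℂ) (exp (l * θ * I)) = exp (((k : ℂ) - l) * I * θ) := by
    intro θ
    rw [← exp_conj, ← exp_add]
    congr 1
    simp
    ring
  simp only [this]
  split_ifs with h
  · subst h; simp; ring
  · have hkl : ((k : ℂ) - l) * I ≠ 0 := by
      apply mul_ne_zero _ I_ne_zero
      rw [sub_ne_zero]
      exact_mod_cast h
    rw [integral_exp_mul_complex hkl, div_eq_zero_iff]
    left
    rw [sub_eq_zero, exp_eq_exp_iff_exists_int]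
    refine ⟨(k : ℤ) - l, ?_⟩
    push_cast
    ring

open Complex in
lemma parseval (c : ℕ → ℂ) (hc : Summable fun k => ‖c k‖) :
    HasSum (fun k => 2 * Real.pi * ‖c k‖ ^ 2) 
      (∫ θ in (-Real.pi)..Real.pi, ‖∑' k, c k * exp (k * (θ:ℝ) * I)‖ ^ 2) := by
  have hn : ∀ (k : ℕ) (θ : ℝ), ‖exp (k * θ * I)‖ = 1 := by
    intro k θ
    have := Complex.norm_exp_ofReal_mul_I (k * θ)
    push_cast at this
    exact this
  have hcont : Continuous fun θ : ℝ => ∑' k, c k * exp (k * (θ:ℝ) * I) := by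
    apply continuous_tsum _ hc
    · intro k θ; rw [norm_mul, hn, mul_one]
    · intro k; fun_prop
  have h1 := parseval_aux c hc (fun θ => (starRingEnd ℂ) (∑' k, c k * exp (k * (θ:ℝ) * I))) 
    (Complex.continuous_conj.comp hcont)
  have h2 : ∀ k : ℕ, ∫ θ in (-Real.pi)..Real.pi, exp (k * (θ:ℝ) * I) * (starRingEnd ℂ) (∑' k, c k * exp (k * (θ:ℝ) * I))
      = (starRingEnd ℂ) (c k) * (2 * Real.pi) := by
    intro k
    have h3 := (parseval_aux c hc (fun θ => (starRingEnd ℂ) (exp (k * (θ:ℝ) * I))) (by fun_prop)).tsum_eq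
    simp only [orth] at h3
    rw [tsum_eq_single k (by intro l hl; simp [hl])] at h3
    simp only [if_true] at h3
    have h4 := congrArg (starRingEnd ℂ) h3
    rw [intervalIntegral.integral_of_le (by linarith [Real.pi_pos]), ← integral_conj] at h4
    rw [intervalIntegral.integral_of_le (by linarith [Real.pi_pos])]
    simp only [map_mul, Complex.conj_conj] at h4
    simp only [mul_comm (exp _)]
    rw [← h4]
    simp
    left
    exact map_ofNat _ 2
  simp only [h2] at h1
  have h5 := Complex.hasSum_re h1
  convert h5 using 1
  · funext k
    have : c k * ((starRingEnd ℂ) (c k) * (2 * Real.pi)) = ((2 * Real.pi * ‖c k‖ ^ 2 : ℝ) : ℂ) := by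
      rw [← mul_assoc, mul_conj, Complex.normSq_eq_norm_sq]; push_cast; ring
    rw [this, ofReal_re]
  · have : ∀ θ : ℝ, (∑' k, c k * exp (k * (θ:ℝ) * I)) * (starRingEnd ℂ) (∑' k, c k * exp (k * (θ:ℝ) * I)) = 
       ((‖∑' k, c k * exp (k * (θ:ℝ) * I)‖ ^ 2 : ℝ) : ℂ) := by
      intro θ
      rw [mul_conj, Complex.normSq_eq_norm_sq]
    simp only [this]
    rw [intervalIntegral.integral_ofReal, ofReal_re]

open Complex in
lemma parseval_lint (c : ℕ → ℂ) (hc : Summable fun k => ‖c k‖) :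
    ∫⁻ θ in Set.Ioo (-Real.pi) Real.pi, ENNReal.ofReal (‖∑' k, c k * exp (k * (θ:ℝ) * I)‖ ^ 2) =
    ∑' k, ENNReal.ofReal (2 * Real.pi * ‖c k‖ ^ 2) := by
  have hn : ∀ (k : ℕ) (θ : ℝ), ‖exp (k * θ * I)‖ = 1 := by
    intro k θ
    have := Complex.norm_exp_ofReal_mul_I (k * θ)
    push_cast at this
    exact this
  have hcont : Continuous fun θ : ℝ => ∑' k, c k * exp (k * (θ:ℝ) * I) := by
    apply continuous_tsum _ hc
    · intro k θ; rw [norm_mul, hn, mul_one]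
    · intro k; fun_prop
  have h := parseval c hc
  rw [← ENNReal.ofReal_tsum_of_nonneg (fun k => by positivity) h.summable, h.tsum_eq, 
    intervalIntegral.integral_of_le (by linarith [Real.pi_pos]), integral_Ioc_eq_integral_Ioo,
    ofReal_integral_eq_lintegral_ofReal]
  · have : IntegrableOn (fun θ : ℝ => ‖∑' k, c k * exp (k * (θ:ℝ) * I)‖ ^ 2) (Set.Icc (-Real.pi) Real.pi) :=
      Continuous.integrableOn_Icc (by fun_prop)
    exact this.mono_set Set.Ioo_subset_Icc_self
  · exact Filter.Eventually.of_forall fun θ => by positivity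

lemma disc_lint (j : ℕ) (c : ℕ → ℂ) (G : ℂ → ℂ) (hG : Measurable G)
    (hs : ∀ z ∈ Metric.ball (0:ℂ) 1, HasSum (fun k => c k * z ^ k) (G z)) :
    ∫⁻ z in Metric.ball (0:ℂ) 1, ENNReal.ofReal (‖G z‖ ^ 2 * (1 - ‖z‖ ^ 2) ^ j) ∂area = 
     ∑' k, ENNReal.ofReal (‖c k‖ ^ 2 * ((k.factorial * j.factorial : ℝ) / (k + j + 1).factorial)) := by
  have hvol : ∫⁻ z in Metric.ball (0:ℂ) 1, ENNReal.ofReal (‖G z‖ ^ 2 * (1 - ‖z‖ ^ 2) ^ j) = 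
     ENNReal.ofReal Real.pi * ∑' k, ENNReal.ofReal (‖c k‖ ^ 2 * ((k.factorial * j.factorial : ℝ) / (k + j + 1).factorial)) := by
    rw [← lintegral_indicator Metric.isOpen_ball.measurableSet, ← Complex.lintegral_comp_polarCoord_symm,
      polarCoord_target, Measure.volume_eq_prod, setLIntegral_prod]
    swap
    · apply Measurable.aemeasurable
      refine Measurable.smul (f := fun p : ℝ × ℝ => ENNReal.ofReal p.1) (by fun_prop) ?_
      · have h1 : Measurable fun p : ℝ × ℝ => Complex.polarCoord.symm p := by
          simp only [Complex.polarCoord_symm_apply]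
          fun_prop
        have h2 : Measurable ((Metric.ball (0:ℂ) 1).indicator fun z => ENNReal.ofReal (‖G z‖ ^ 2 * (1 - ‖z‖ ^ 2) ^ j)) := by
          apply Measurable.indicator _ Metric.isOpen_ball.measurableSet
          fun_prop
        exact h2.comp h1
    have key : ∀ r ∈ Set.Ioi (0:ℝ), ∫⁻ θ in Set.Ioo (-Real.pi) Real.pi, 
        ENNReal.ofReal r • (Metric.ball (0:ℂ) 1).indicator (fun z => ENNReal.ofReal (‖G z‖ ^ 2 * (1 - ‖z‖ ^ 2) ^ j)) (Complex.polarCoord.symm (r, θ)) = 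
        (Set.Ioo (0:ℝ) 1).indicator (fun r => ∑' k, ENNReal.ofReal (Real.pi * ‖c k‖ ^ 2) * ENNReal.ofReal (2 * r ^ (2 * k + 1) * (1 - r ^ 2) ^ j)) r := by
      intro r hr
      have hr0 : 0 < r := hr
      have hnorm : ∀ θ, ‖Complex.polarCoord.symm (r, θ)‖ = r := by
        intro θ; rw [Complex.norm_polarCoord_symm]; exact abs_of_pos hr0
      by_cases h1 : r < 1
      · rw [Set.indicator_of_mem (show r ∈ Set.Ioo (0:ℝ) 1 from ⟨hr0, h1⟩)]
        have hr2 : 0 ≤ 1 - r ^ 2 := by nlinarith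
        have hmem : ∀ θ, Complex.polarCoord.symm (r, θ) ∈ Metric.ball (0:ℂ) 1 := by
          intro θ; rw [mem_ball_zero_iff, hnorm]; exact h1
        have hcs : Summable fun k => ‖c k * r ^ k‖ := by
          have := (hs r (by rw [mem_ball_zero_iff, Complex.norm_real, Real.norm_of_nonneg hr0.le]; exact h1)).summable.norm
          exact this
        have hGe : ∀ θ : ℝ, G (Complex.polarCoord.symm (r, θ)) = ∑' k : ℕ, (c k * r ^ k) * Complex.exp (k * θ * Complex.I) := by
          intro θ
          rw [← (hs _ (hmem θ)).tsum_eq]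
          apply tsum_congr
          intro k
          rw [Complex.polarCoord_symm_apply, mul_pow, mul_assoc]
          congr 2
          simp only
          rw [mul_assoc, Complex.exp_nat_mul, Complex.exp_mul_I]
          push_cast
          rfl
        have := parseval_lint (fun k => c k * r ^ k) hcs
        have hint : ∀ θ : ℝ, ENNReal.ofReal r • (Metric.ball (0:ℂ) 1).indicator (fun z => ENNReal.ofReal (‖G z‖ ^ 2 * (1 - ‖z‖ ^ 2) ^ j)) (Complex.polarCoord.symm (r, θ)) =
            ENNReal.ofReal (‖∑' k : ℕ, (c k * r ^ k) * Complex.exp (k * θ * Complex.I)‖ ^ 2) * ENNReal.ofReal (r * (1 - r ^ 2) ^ j) := by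
          intro θ
          rw [Set.indicator_of_mem (hmem θ), hnorm, hGe, smul_eq_mul, ← ENNReal.ofReal_mul hr0.le,
            ← ENNReal.ofReal_mul (by positivity)]
          congr 1; ring
        simp only [hint]
        rw [lintegral_mul_const' _ _ ENNReal.ofReal_ne_top, this, ← ENNReal.tsum_mul_right]
        apply tsum_congr
        intro k
        rw [← ENNReal.ofReal_mul (by positivity), ← ENNReal.ofReal_mul (by positivity), norm_mul, norm_pow,
          Complex.norm_real, Real.norm_of_nonneg hr0.le]
        congr 1
        ring
      · rw [Set.indicator_of_notMem (fun h => h1 h.2)]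
        have hint : ∀ θ : ℝ, ENNReal.ofReal r • (Metric.ball (0:ℂ) 1).indicator (fun z => ENNReal.ofReal (‖G z‖ ^ 2 * (1 - ‖z‖ ^ 2) ^ j)) (Complex.polarCoord.symm (r, θ)) = 0 := by
          intro θ
          rw [Set.indicator_of_notMem, smul_zero]
          rw [mem_ball_zero_iff, hnorm]; exact h1
        simp only [hint]
        simp
    rw [setLIntegral_congr_fun measurableSet_Ioi key, setLIntegral_indicator measurableSet_Ioo,
      Set.inter_eq_left.2 Set.Ioo_subset_Ioi_self, lintegral_tsum, ← ENNReal.tsum_mul_left]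
    · apply tsum_congr
      intro k
      rw [lintegral_const_mul' _ _ ENNReal.ofReal_ne_top, beta_lint, ← ENNReal.ofReal_mul (by positivity),
        ← ENNReal.ofReal_mul (by positivity)]
      congr 1
      ring
    · intro k
      apply Measurable.aemeasurable
      fun_prop
  rw [area, Measure.restrict_smul, lintegral_smul_measure, hvol, smul_eq_mul, ← mul_assoc, 
    ENNReal.inv_mul_cancel, one_mul]
  · simpa using Real.pi_pos
  · exact ENNReal.ofReal_ne_top


noncomputable def tc (f : ℂ → ℂ) (m : ℕ) : ℂ := iteratedDeriv m f 0 / (m.factorial : ℂ)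

lemma bshift_eq (f : ℂ → ℂ) : bshift f = dslope f 0 := by
  funext z
  unfold bshift
  split_ifs with h
  · subst h; simp
  · rw [dslope_of_ne _ h, slope_def_field, sub_zero]

lemma bshift_diff (f : ℂ → ℂ) (hf : DifferentiableOn ℂ f (Metric.ball (0 : ℂ) 1)) :
    DifferentiableOn ℂ (bshift f) (Metric.ball (0 : ℂ) 1) := by
  rw [bshift_eq]
  exact (Complex.differentiableOn_dslope (Metric.ball_mem_nhds _ one_pos)).2 hf

lemma tc_bshift (f : ℂ → ℂ) (hf : DifferentiableOn ℂ f (Metric.ball (0 : ℂ) 1)) (m : ℕ) :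
    tc (bshift f) m = tc f (m + 1) := by
  have h1 := (hf.analyticAt (Metric.ball_mem_nhds _ one_pos)).hasFPowerSeriesAt
  have h2 := ((bshift_diff f hf).analyticAt (Metric.ball_mem_nhds _ one_pos)).hasFPowerSeriesAt
  rw [bshift_eq] at h2
  have h3 := h2.eq_formalMultilinearSeries h1.has_fpower_series_dslope_fslope
  have h4 := congrArg (fun q => FormalMultilinearSeries.coeff q m) h3
  simp only [FormalMultilinearSeries.coeff_ofScalars, FormalMultilinearSeries.coeff_fslope] at h4
  rw [bshift_eq]
  exact h4

lemma bshift_iter (f : ℂ → ℂ) (hf : DifferentiableOn ℂ f (Metric.ball (0 : ℂ) 1)) (k : ℕ) :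
    DifferentiableOn ℂ (bshift^[k] f) (Metric.ball (0 : ℂ) 1) ∧
      ∀ m, tc (bshift^[k] f) m = tc f (m + k) := by
  induction k with
  | zero => exact ⟨hf, fun m => rfl⟩
  | succ k ih =>
    rw [Function.iterate_succ_apply']
    refine ⟨bshift_diff _ ih.1, fun m => ?_⟩
    rw [tc_bshift _ ih.1, ih.2]
    congr 1; omega

lemma iter_diff (f : ℂ → ℂ) (hf : DifferentiableOn ℂ f (Metric.ball (0 : ℂ) 1)) (j : ℕ) :
    DifferentiableOn ℂ (iteratedDeriv j f) (Metric.ball (0 : ℂ) 1) := by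
  induction j with
  | zero => simpa using hf
  | succ j ih => rw [iteratedDeriv_succ]; exact ih.deriv Metric.isOpen_ball

lemma iter_series (f : ℂ → ℂ) (hf : DifferentiableOn ℂ f (Metric.ball (0 : ℂ) 1)) (j : ℕ)
    (z : ℂ) (hz : z ∈ Metric.ball (0 : ℂ) 1) :
    HasSum (fun i : ℕ => (((i + j).factorial : ℂ) / i.factorial * tc f (i + j)) * z ^ i)
      (iteratedDeriv j f z) := by
  have h := Complex.hasSum_taylorSeries_on_ball (iter_diff f hf j) hz
  have hfe : (fun i : ℕ => (((i + j).factorial : ℂ) / i.factorial * tc f (i + j)) * z ^ i) =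
      fun i : ℕ => ((i.factorial : ℂ))⁻¹ • (z - 0) ^ i • iteratedDeriv i (iteratedDeriv j f) 0 := ?_
  · rw [hfe]; exact h
  funext i
  have : iteratedDeriv i (iteratedDeriv j f) 0 = iteratedDeriv (i + j) f 0 := by
    simp only [iteratedDeriv_eq_iterate, Function.iterate_add_apply]
  rw [this, tc, sub_zero, smul_eq_mul, smul_eq_mul]
  have h1 : ((i + j).factorial : ℂ) ≠ 0 := by exact_mod_cast Nat.factorial_ne_zero _
  have h2 : ((i).factorial : ℂ) ≠ 0 := by exact_mod_cast Nat.factorial_ne_zero _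
  field_simp

lemma fact_id (p k : ℕ) (x : ℝ) :
    ((((p + 1).factorial * p.factorial : ℕ) : ℝ))⁻¹ * ((((p + 1).factorial : ℝ) * x) ^ 2 *
      ((k.factorial * (p + 1).factorial : ℝ) / (k + (p + 1) + 1).factorial)) =
    sw p (k + (p + 1)) * x ^ 2 := by
  have c1 : (Nat.choose (k + (p + 1)) p : ℝ) = (k + (p + 1)).factorial / (p.factorial * (k + 1).factorial) := by
    rw [Nat.cast_choose ℝ (by omega : p ≤ k + (p + 1)), show k + (p + 1) - p = k + 1 by omega]
  have c2 : (Nat.choose (k + (p + 1)) (p + 1) : ℝ) = (k + (p + 1)).factorial / ((p + 1).factorial * k.factorial) := by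
    rw [Nat.cast_choose ℝ (by omega), show k + (p + 1) - (p + 1) = k by omega]
  have c3 : (Nat.choose (k + (p + 1) + 1) (p + 1) : ℝ) = (k + (p + 1) + 1).factorial / ((p + 1).factorial * (k + 1).factorial) := by
    rw [Nat.cast_choose ℝ (by omega), show k + (p + 1) + 1 - (p + 1) = k + 1 by omega]
  rw [sw, c1, c2, c3]
  have h1 := Nat.factorial_ne_zero p
  have h2 := Nat.factorial_ne_zero (p + 1)
  have h3 := Nat.factorial_ne_zero k
  have h4 := Nat.factorial_ne_zero (k + 1)
  have h5 := Nat.factorial_ne_zero (k + (p + 1))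
  have h6 := Nat.factorial_ne_zero (k + (p + 1) + 1)
  push_cast
  field_simp

lemma iter_meas (f : ℂ → ℂ) (p : ℕ) : Measurable (iteratedDeriv (p + 1) f) := by
  rw [iteratedDeriv_succ]; exact measurable_deriv _

lemma point_eq (p : ℕ) (f : ℂ → ℂ) (hf : DifferentiableOn ℂ f (Metric.ball (0 : ℂ) 1)) (l : ℂ)
    (hl : ‖l‖ = 1) :
    ((((p + 1).factorial * p.factorial : ℕ) : ℝ≥0∞))⁻¹ * 
      ∫⁻ z in Metric.ball (0 : ℂ) 1, ENNReal.ofReal ((1 - ‖z‖ ^ 2) / ‖z - l‖ ^ 2) * 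
        ENNReal.ofReal (‖iteratedDeriv (p + 1) f z‖ ^ 2 * (1 - ‖z‖ ^ 2) ^ p) ∂area = 
    sD p (fun m => tc f m * l ^ m) := by
  have hl0 : l ≠ 0 := by intro h; rw [h] at hl; simp at hl
  set G : ℂ → ℂ := fun z => iteratedDeriv (p + 1) f z * (z - l)⁻¹ with hG
  set e : ℕ → ℂ := fun i => ((i + (p + 1)).factorial : ℂ) / i.factorial * tc f (i + (p + 1)) with he
  set c : ℕ → ℂ := fun k => ∑ i ∈ Finset.range (k + 1), e i * (- (l⁻¹) ^ (k - i + 1)) with hc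
  have hGm : Measurable G := (iter_meas f p).mul (by fun_prop)
  have hsum : ∀ z ∈ Metric.ball (0:ℂ) 1, HasSum (fun k => c k * z ^ k) (G z) := by
    intro z hz
    have h1 := iter_series f hf (p + 1) z hz
    have hz' : ‖l⁻¹ * z‖ < 1 := by
      rw [norm_mul, norm_inv, hl]; simpa using hz
    have h2 : HasSum (fun i => (-(l⁻¹) ^ (i + 1)) * z ^ i) ((z - l)⁻¹) := by
      have := (hasSum_geometric_of_norm_lt_one hz').mul_left (-l⁻¹)
      have e1 : (fun i => (-(l⁻¹) ^ (i + 1)) * z ^ i) = fun i => -l⁻¹ * (l⁻¹ * z) ^ i := by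
        funext i; rw [mul_pow]; ring
      have e2 : (z - l)⁻¹ = -l⁻¹ * (1 - l⁻¹ * z)⁻¹ := by
        rw [neg_mul, ← mul_inv, ← inv_neg]
        congr 1
        field_simp
        ring
      rw [e1, e2]; exact this
    have h3 := hasSum_sum_range_mul_of_summable_norm h1.summable.norm h2.summable.norm
    rw [h1.tsum_eq, h2.tsum_eq] at h3
    have hk : ∀ k, c k * z ^ k = ∑ i ∈ Finset.range (k + 1), (((i + (p + 1)).factorial : ℂ) / i.factorial * tc f (i + (p + 1)) * z ^ i) * (-(l⁻¹) ^ (k - i + 1) * z ^ (k - i)) := by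
      intro k
      simp only [hc, Finset.sum_mul]
      apply Finset.sum_congr rfl
      intro i hi
      have : i ≤ k := by have := Finset.mem_range.1 hi; omega
      have hzk : z ^ k = z ^ i * z ^ (k - i) := by rw [← pow_add]; congr 1; omega
      rw [hzk]
      simp only [he]
      ring
    have hfe : (fun k => c k * z ^ k) = _ := funext fun k => hk k
    rw [hfe]
    exact h3
  have hcn : ∀ k, ‖c k‖ = ((p + 1).factorial : ℝ) * ‖sS (p + 1) (fun m => tc f m * l ^ m) (k + (p + 1))‖ := by
    intro k
    have h1 : sS (p + 1) (fun m => tc f m * l ^ m) (k + (p + 1)) = 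
        ∑ i ∈ Finset.range (k + 1), (Nat.choose (i + (p + 1)) (p + 1) : ℂ) * (tc f (i + (p + 1)) * l ^ (i + (p + 1))) := by
      rw [sS, show k + (p + 1) + 1 = (p + 1) + (k + 1) by omega, Finset.sum_range_add, Finset.sum_eq_zero, zero_add]
      · apply Finset.sum_congr rfl
        intro i _
        rw [add_comm (p + 1) i]
      · intro i hi
        rw [Nat.choose_eq_zero_of_lt (Finset.mem_range.1 hi)]; simp
    have h2 : c k * (- l ^ (k + 1 + (p + 1))) = ((p + 1).factorial : ℂ) * sS (p + 1) (fun m => tc f m * l ^ m) (k + (p + 1)) := by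
      rw [h1, hc, Finset.sum_mul, Finset.mul_sum]
      apply Finset.sum_congr rfl
      intro i hi
      have hik : i ≤ k := by have := Finset.mem_range.1 hi; omega
      have hpow : l ^ (k + 1 + (p + 1)) = l ^ (k - i + 1) * l ^ (i + (p + 1)) := by
        rw [← pow_add]; congr 1; omega
      have hch : (Nat.choose (i + (p + 1)) (p + 1) : ℂ) = (i + (p + 1)).factorial / ((p + 1).factorial * i.factorial) := by
        rw [Nat.cast_choose ℂ (by omega), show i + (p + 1) - (p + 1) = i by omega]
      have f1 : ((p + 1).factorial : ℂ) ≠ 0 := by exact_mod_cast Nat.factorial_ne_zero _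
      have f2 : (i.factorial : ℂ) ≠ 0 := by exact_mod_cast Nat.factorial_ne_zero _
      rw [hpow, hch, inv_pow]
      simp only [he]
      field_simp
    have h3 := congrArg norm h2
    simpa [hl] using h3
  have hint : ∀ z ∈ Metric.ball (0:ℂ) 1, ENNReal.ofReal ((1 - ‖z‖ ^ 2) / ‖z - l‖ ^ 2) * 
        ENNReal.ofReal (‖iteratedDeriv (p + 1) f z‖ ^ 2 * (1 - ‖z‖ ^ 2) ^ p) = 
        ENNReal.ofReal (‖G z‖ ^ 2 * (1 - ‖z‖ ^ 2) ^ (p + 1)) := by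
    intro z hz
    rw [mem_ball_zero_iff] at hz
    have h1 : 0 ≤ 1 - ‖z‖ ^ 2 := by nlinarith [norm_nonneg z]
    rw [← ENNReal.ofReal_mul (by positivity)]
    congr 1
    simp only [hG, norm_mul, norm_inv]
    rw [pow_succ]
    ring
  rw [setLIntegral_congr_fun Metric.isOpen_ball.measurableSet hint, disc_lint (p + 1) c G hGm hsum,
    ← ENNReal.tsum_mul_left, sD]
  rw [← Summable.sum_add_tsum_nat_add' (k := p + 1) (f := fun N => ENNReal.ofReal (sw p N * ‖sS (p + 1) (fun m => tc f m * l ^ m) N‖ ^ 2)) ENNReal.summable,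
    Finset.sum_eq_zero, zero_add]
  · apply tsum_congr
    intro k
    rw [hcn, ← fact_id, ENNReal.ofReal_mul (p := (_)⁻¹) (by positivity), ENNReal.ofReal_inv_of_pos, ENNReal.ofReal_natCast]
    have := Nat.factorial_pos p
    have := Nat.factorial_pos (p + 1)
    exact_mod_cast Nat.mul_pos ‹_› ‹_›
  · intro N hN
    rw [sw, Nat.choose_eq_zero_of_lt (Finset.mem_range.1 hN)]
    simp

instance : SFinite area := by unfold area; infer_instance

lemma poisson_ofReal (μ : Measure ℂ) [IsFiniteMeasure μ] (hμ : ∀ᵐ l ∂μ, ‖l‖ = 1) (z : ℂ)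
    (hz : z ∈ Metric.ball (0:ℂ) 1) :
    0 ≤ poisson μ z ∧
    ENNReal.ofReal (poisson μ z) = ∫⁻ l, ENNReal.ofReal ((1 - ‖z‖ ^ 2) / ‖z - l‖ ^ 2) ∂μ := by
  rw [mem_ball_zero_iff] at hz
  have h1 : 0 ≤ 1 - ‖z‖ ^ 2 := by nlinarith [norm_nonneg z]
  refine ⟨integral_nonneg fun l => by positivity, ?_⟩
  rw [poisson, ofReal_integral_eq_lintegral_ofReal]
  · apply Integrable.of_bound (C := (1 - ‖z‖ ^ 2) / (1 - ‖z‖) ^ 2)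
    · filter_upwards [hμ] with l hl
      rw [Real.norm_of_nonneg (by positivity)]
      have h2 : 1 - ‖z‖ ≤ ‖z - l‖ := by
        have := norm_sub_norm_le l z
        rw [norm_sub_rev, hl] at this
        exact this
      have h3 : 0 < 1 - ‖z‖ := by linarith
      gcongr
    · apply Measurable.aestronglyMeasurable
      fun_prop
  · exact Filter.Eventually.of_forall fun l => by simp only [Pi.zero_apply]; positivity

lemma eDirichlet_eq (μ : Measure ℂ) [IsFiniteMeasure μ] (hμ : ∀ᵐ l ∂μ, ‖l‖ = 1) (p : ℕ) (f : ℂ → ℂ)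
    (hf : DifferentiableOn ℂ f (Metric.ball (0 : ℂ) 1)) :
    eDirichlet μ (p + 1) f = ∫⁻ l, sD p (fun m => tc f m * l ^ m) ∂μ := by
  have hne : ((((p + 1).factorial * p.factorial : ℕ) : ℝ≥0∞))⁻¹ ≠ ⊤ := by
    rw [ENNReal.inv_ne_top]
    exact_mod_cast Nat.mul_ne_zero (Nat.factorial_ne_zero _) (Nat.factorial_ne_zero _)
  have hm := iter_meas f p
  rw [eDirichlet, Nat.add_sub_cancel]
  have h1 : ∀ z ∈ Metric.ball (0:ℂ) 1, 
      ENNReal.ofReal (poisson μ z * ‖iteratedDeriv (p + 1) f z‖ ^ 2 * (1 - ‖z‖ ^ 2) ^ p) = 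
      ∫⁻ l, ENNReal.ofReal ((1 - ‖z‖ ^ 2) / ‖z - l‖ ^ 2) * 
        ENNReal.ofReal (‖iteratedDeriv (p + 1) f z‖ ^ 2 * (1 - ‖z‖ ^ 2) ^ p) ∂μ := by
    intro z hz
    obtain ⟨ha, hb⟩ := poisson_ofReal μ hμ z hz
    rw [lintegral_mul_const' _ _ ENNReal.ofReal_ne_top, ← hb, ← ENNReal.ofReal_mul ha, mul_assoc]
  rw [setLIntegral_congr_fun Metric.isOpen_ball.measurableSet h1, lintegral_lintegral_swap,
    ← lintegral_const_mul' _ _ hne]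
  · apply lintegral_congr_ae
    filter_upwards [hμ] with l hl
    exact point_eq p f hf l hl
  · apply Measurable.aemeasurable
    simp only [Function.uncurry_def]
    have : Measurable fun x : ℂ × ℂ => iteratedDeriv (p + 1) f x.1 := hm.comp measurable_fst
    fun_prop

theorem eDirichlet_bshift_sum (μ : Measure ℂ) [IsFiniteMeasure μ]
    (hμ : μ {z : ℂ | ‖z‖ ≠ 1} = 0) (n : ℕ) (hn : 2 ≤ n) (f : ℂ → ℂ)
    (hf : DifferentiableOn ℂ f (Metric.ball (0 : ℂ) 1))
    (hfin : eDirichlet μ n f ≠ ⊤) (j : ℕ) (hj1 : 1 ≤ j) (hj2 : j ≤ n - 1) :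
    ∑' k : ℕ, eDirichlet μ j (bshift^[k + 1] f) = eDirichlet μ (j + 1) f := by
  have hμ' : ∀ᵐ l ∂μ, ‖l‖ = 1 := by rw [ae_iff]; exact hμ
  obtain ⟨p, rfl⟩ : ∃ p, j = p + 1 := ⟨j - 1, by omega⟩
  rw [eDirichlet_eq μ hμ' (p + 1) f hf]
  have h1 : ∀ k : ℕ, eDirichlet μ (p + 1) (bshift^[k + 1] f) = 
      ∫⁻ l, sD p (fun m => tc f (m + (k + 1)) * l ^ (m + (k + 1))) ∂μ := by
    intro k
    obtain ⟨ha, hb⟩ := bshift_iter f hf (k + 1)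
    rw [eDirichlet_eq μ hμ' p _ ha]
    apply lintegral_congr_ae
    filter_upwards [hμ'] with l hl
    simp only [hb]
    unfold sD
    apply tsum_congr
    intro N
    have : sS (p + 1) (fun m => tc f (m + (k + 1)) * l ^ (m + (k + 1))) N = 
        sS (p + 1) (fun m => tc f (m + (k + 1)) * l ^ m) N * l ^ (k + 1) := by
      simp only [sS, Finset.sum_mul]
      apply Finset.sum_congr rfl
      intro i _
      ring
    rw [this, norm_mul, norm_pow, hl, one_pow, mul_one]
  simp only [h1]
  rw [← lintegral_tsum]
  · apply lintegral_congr
    intro l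
    exact seq_main p (fun m => tc f m * l ^ m)
  · intro k
    apply Measurable.aemeasurable
    unfold sD sS
    refine Measurable.tsum fun N => ?_
    fun_prop
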